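/- arXiv:1006.4341 — 4 statements merged into one kernel-verified Lean document; each statement's English description precedes it below -/
import Mathlib

section
/- Let n ≥ 1, let F : ℝ × ℝⁿ × ℝⁿ → ℝ be continuously differentiable, let t₀ < t₁, and let x : [t₀, t₁] → ℝⁿ be continuously differentiable such that the map t ↦ ∇_{ẋ}F(t, x(t), ẋ(t)) is continuously differentiable on [t₀, t₁]. Suppose x is an extremal of the functional J, i.e., for every continuously differentiable H : [t₀, t₁] → ℝⁿ with H(t₀) = H(t₁) = 0, the function ε ↦ ∫_{t₀}^{t₁} F(t, x(t) + εH(t), ẋ(t) + εḢ(t)) dt has derivative 0 at ε = 0. Then x satisfies the Euler equations of the calculus of variations: for every i = 1, …, n and every t ∈ [t₀, t₁], ∂F/∂xⁱ(t, x(t), ẋ(t)) − (d/dt)[∂F/∂ẋⁱ(t, x(t), ẋ(t))] = 0. -/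
/-- Differentiation of the functional `∫ F(t, x, ẋ) dt` along a variation `(h, h')`. -/
theorem hasDerivAt_integral_variation {E : Type*} [NormedAddCommGroup E] [NormedSpace ℝ E]
    {F : ℝ × E × E → ℝ} (hF : ContDiff ℝ 1 F) {a b : ℝ} (hab : a ≤ b)
    {x x' h h' : ℝ → E} (hx : ContinuousOn x (Set.Icc a b)) (hx' : ContinuousOn x' (Set.Icc a b))
    (hh : ContinuousOn h (Set.Icc a b)) (hh' : ContinuousOn h' (Set.Icc a b)) :
    HasDerivAt (fun ε : ℝ => ∫ t in a..b, F (t, x t + ε • h t, x' t + ε • h' t))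
      (∫ t in a..b, fderiv ℝ F (t, x t, x' t) (0, h t, h' t)) 0 := by
  set γ : ℝ × ℝ → ℝ × E × E := fun p => (p.2, x p.2 + p.1 • h p.2, x' p.2 + p.1 • h' p.2)
    with hγ
  set D : ℝ × ℝ → ℝ := fun p => fderiv ℝ F (γ p) (0, h p.2, h' p.2) with hD
  have hmaps : Set.MapsTo Prod.snd (Set.Icc (-1 : ℝ) 1 ×ˢ Set.Icc a b) (Set.Icc a b) :=
    fun p hp => hp.2
  have lift {f : ℝ → E} (hf : ContinuousOn f (Set.Icc a b)) :
      ContinuousOn (fun p : ℝ × ℝ => f p.2) (Set.Icc (-1 : ℝ) 1 ×ˢ Set.Icc a b) :=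
    hf.comp continuousOn_snd hmaps
  have hγc : ContinuousOn γ (Set.Icc (-1 : ℝ) 1 ×ˢ Set.Icc a b) :=
    continuousOn_snd.prodMk (((lift hx).add (continuousOn_fst.smul (lift hh))).prodMk
      ((lift hx').add (continuousOn_fst.smul (lift hh'))))
  have hDc : ContinuousOn D (Set.Icc (-1 : ℝ) 1 ×ˢ Set.Icc a b) :=
    ((hF.continuous_fderiv one_ne_zero).comp_continuousOn hγc).clm_apply
      (continuousOn_const.prodMk ((lift hh).prodMk (lift hh')))
  obtain ⟨C, hC⟩ := (isCompact_Icc.prod isCompact_Icc).exists_bound_of_continuousOn hDc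
  have slice {f : ℝ × ℝ → ℝ} (hf : ContinuousOn f (Set.Icc (-1 : ℝ) 1 ×ˢ Set.Icc a b))
      {ε : ℝ} (hε : ε ∈ Set.Icc (-1 : ℝ) 1) :
      IntervalIntegrable (fun t => f (ε, t)) MeasureTheory.volume a b := by
    refine ContinuousOn.intervalIntegrable_of_Icc hab ?_
    exact hf.comp (continuousOn_const.prodMk continuousOn_id) fun t ht => ⟨hε, ht⟩
  have hFc := hF.continuous.comp_continuousOn hγc
  have h0 : (0 : ℝ) ∈ Set.Icc (-1 : ℝ) 1 := by simp
  have hball : Metric.ball (0 : ℝ) 1 ⊆ Set.Icc (-1 : ℝ) 1 := by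
    rw [Real.ball_eq_Ioo]
    simpa using Set.Ioo_subset_Icc_self
  have key := (intervalIntegral.hasDerivAt_integral_of_dominated_loc_of_deriv_le
    (μ := MeasureTheory.volume) (F := fun ε t => F (γ (ε, t))) (F' := fun ε t => D (ε, t))
    (x₀ := (0 : ℝ)) (s := Metric.ball 0 1) (bound := fun _ => C) (a := a) (b := b)
    (Metric.ball_mem_nhds 0 one_pos) ?_ (slice hFc h0)
    (slice hDc h0).def'.aestronglyMeasurable ?_ intervalIntegrable_const ?_).2
  · simpa [hD, hγ] using key
  · filter_upwards [Metric.ball_mem_nhds (0 : ℝ) one_pos] with ε hε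
    exact (slice hFc (hball hε)).def'.aestronglyMeasurable
  · refine Filter.Eventually.of_forall fun t ht ε hε => hC (ε, t) ⟨hball hε, ?_⟩
    rw [Set.uIoc_of_le hab] at ht
    exact Set.Ioc_subset_Icc_self ht
  · refine Filter.Eventually.of_forall fun t _ ε _ => ?_
    have hline (u v : E) : HasDerivAt (fun ε : ℝ => u + ε • v) v ε := by
      simpa using ((hasDerivAt_id ε).smul_const v).const_add u
    exact (hF.differentiable one_ne_zero (γ (ε, t))).hasFDerivAt.comp_hasDerivAt ε
      ((hasDerivAt_const ε t).prodMk ((hline (x t) (h t)).prodMk (hline (x' t) (h' t))))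

/-- The fundamental lemma of the calculus of variations for a continuous function on a segment. -/
theorem eqOn_zero_of_integral_contDiff_mul_eq_zero {f : ℝ → ℝ} {a b : ℝ} (hab : a < b)
    (hf : ContinuousOn f (Set.Icc a b))
    (h : ∀ g : ℝ → ℝ, ContDiff ℝ 1 g → g a = 0 → g b = 0 → ∫ t in a..b, g t * f t = 0) :
    Set.EqOn f 0 (Set.Icc a b) := by
  have hae : ∀ᵐ t, t ∈ Set.Ioo a b → f t = 0 := by
    refine isOpen_Ioo.ae_eq_zero_of_integral_contDiff_smul_eq_zero
      ((hf.mono Set.Ioo_subset_Icc_self).locallyIntegrableOn measurableSet_Ioo) ?_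
    intro g hg _ hsupp
    have hzero {t : ℝ} (ht : t ∉ Set.Ioo a b) : g t = 0 :=
      image_eq_zero_of_notMem_tsupport fun ht' => ht (hsupp ht')
    have := h g (hg.of_le (by exact_mod_cast le_top)) (hzero (by simp)) (hzero (by simp))
    rw [intervalIntegral.integral_of_le hab.le,
      MeasureTheory.setIntegral_eq_integral_of_forall_compl_eq_zero] at this
    · simpa using this
    · intro t ht
      rw [hzero fun ht' => ht (Set.Ioo_subset_Ioc_self ht'), zero_mul]
  refine MeasureTheory.Measure.eqOn_Icc_of_ae_eq MeasureTheory.volume hab.ne ?_ hf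
    continuousOn_const
  rw [← MeasureTheory.restrict_Ioo_eq_restrict_Icc]
  exact (MeasureTheory.ae_restrict_iff' measurableSet_Ioo).2 hae


/-- The Euler equations of the calculus of variations: if `x` is an extremal of
`J(x) = ∫_{t₀}^{t₁} F(t, x, ẋ) dt`, i.e. for every `C¹` variation `H` vanishing
at the endpoints the function `ε ↦ ∫_{t₀}^{t₁} F(t, x + εH, ẋ + εḢ) dt` has
derivative `0` at `ε = 0`, then `∂F/∂xⁱ(t, x, ẋ) - d/dt ∂F/∂ẋⁱ(t, x, ẋ) = 0`
for every `i` and every `t ∈ [t₀, t₁]`. -/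
theorem euler_equations_calculus_of_variations
    (n : ℕ) (hn : 1 ≤ n)
    (F : ℝ × (Fin n → ℝ) × (Fin n → ℝ) → ℝ) (hF : ContDiff ℝ 1 F)
    (t₀ t₁ : ℝ) (ht : t₀ < t₁)
    (x x' : ℝ → Fin n → ℝ)
    (hx : ∀ t ∈ Set.Icc t₀ t₁, HasDerivWithinAt x (x' t) (Set.Icc t₀ t₁) t)
    (hx' : ContinuousOn x' (Set.Icc t₀ t₁))
    (G G' : ℝ → Fin n → ℝ)
    (hG : ∀ t ∈ Set.Icc t₀ t₁,
      G t = fun i => fderiv ℝ F (t, x t, x' t) (0, 0, Pi.single i 1))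
    (hGd : ∀ t ∈ Set.Icc t₀ t₁, HasDerivWithinAt G (G' t) (Set.Icc t₀ t₁) t)
    (hG' : ContinuousOn G' (Set.Icc t₀ t₁))
    (hext : ∀ H H' : ℝ → Fin n → ℝ,
      (∀ t ∈ Set.Icc t₀ t₁, HasDerivWithinAt H (H' t) (Set.Icc t₀ t₁) t) →
      ContinuousOn H' (Set.Icc t₀ t₁) → H t₀ = 0 → H t₁ = 0 →
      HasDerivAt
        (fun ε : ℝ => ∫ t in t₀..t₁, F (t, x t + ε • H t, x' t + ε • H' t)) 0 0) :
    ∀ i : Fin n, ∀ t ∈ Set.Icc t₀ t₁,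
      fderiv ℝ F (t, x t, x' t) (0, Pi.single i 1, 0) - G' t i = 0 := by
  intro i
  have hxc : ContinuousOn x (Set.Icc t₀ t₁) := fun t ht => (hx t ht).continuousWithinAt
  have hγ : ContinuousOn (fun t => fderiv ℝ F (t, x t, x' t)) (Set.Icc t₀ t₁) :=
    (hF.continuous_fderiv one_ne_zero).comp_continuousOn
      (continuousOn_id.prodMk (hxc.prodMk hx'))
  have hGi (t) (ht : t ∈ Set.Icc t₀ t₁) :
      HasDerivWithinAt (fun t => G t i) (G' t i) (Set.Icc t₀ t₁) t :=
    hasDerivWithinAt_pi.1 (hGd t ht) i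
  have hGic : ContinuousOn (fun t => G t i) (Set.Icc t₀ t₁) :=
    fun t ht => (hGi t ht).continuousWithinAt
  have hGic' : ContinuousOn (fun t => G' t i) (Set.Icc t₀ t₁) :=
    (continuous_apply i).comp_continuousOn hG'
  have hFx : ContinuousOn (fun t => fderiv ℝ F (t, x t, x' t) (0, Pi.single i 1, 0))
      (Set.Icc t₀ t₁) := hγ.clm_apply continuousOn_const
  refine eqOn_zero_of_integral_contDiff_mul_eq_zero ht (hFx.sub hGic') fun g hg hg₀ hg₁ => ?_
  set e : Fin n → ℝ := Pi.single i 1 with he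
  have hgd (t : ℝ) : HasDerivAt g (deriv g t) t := (hg.differentiable one_ne_zero t).hasDerivAt
  have hg'c : Continuous (deriv g) := hg.continuous_deriv le_rfl
  have hfirst : ∫ t in t₀..t₁, fderiv ℝ F (t, x t, x' t) (0, g t • e, deriv g t • e) = 0 :=
    (hasDerivAt_integral_variation hF ht.le hxc hx'
      (hg.continuous.smul continuous_const).continuousOn
      (hg'c.smul continuous_const).continuousOn).unique
      (hext (fun t => g t • e) (fun t => deriv g t • e)
        (fun t _ => ((hgd t).smul_const e).hasDerivWithinAt)
        (hg'c.smul continuous_const).continuousOn (by simp [hg₀]) (by simp [hg₁]))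
  have hparts : ∫ t in t₀..t₁, (deriv g t * G t i + g t * G' t i) = 0 := by
    rw [intervalIntegral.integral_eq_sub_of_hasDerivAt_of_le ht.le
      (hg.continuous.continuousOn.mul hGic)
      (fun t ht => (hgd t).mul ((hGi t (Set.Ioo_subset_Icc_self ht)).hasDerivAt
        (Icc_mem_nhds ht.1 ht.2)))
      (((hg'c.continuousOn.mul hGic).add
        (hg.continuous.continuousOn.mul hGic')).intervalIntegrable_of_Icc ht.le)]
    simp [hg₀, hg₁]
  have hsplit (t) (ht : t ∈ Set.Icc t₀ t₁) :
      fderiv ℝ F (t, x t, x' t) (0, g t • e, deriv g t • e) =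
        g t * fderiv ℝ F (t, x t, x' t) (0, e, 0) + deriv g t * G t i := by
    have : ((0, g t • e, deriv g t • e) : ℝ × (Fin n → ℝ) × (Fin n → ℝ)) =
        g t • (0, e, 0) + deriv g t • (0, 0, e) := by simp
    rw [this, map_add, map_smul, map_smul, hG t ht, smul_eq_mul, smul_eq_mul]
  have hint₁ : IntervalIntegrable (fun t => g t * fderiv ℝ F (t, x t, x' t) (0, e, 0)
      + deriv g t * G t i) MeasureTheory.volume t₀ t₁ :=
    ((hg.continuous.continuousOn.mul hFx).add
      (hg'c.continuousOn.mul hGic)).intervalIntegrable_of_Icc ht.le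
  have hint₂ : IntervalIntegrable (fun t => deriv g t * G t i + g t * G' t i)
      MeasureTheory.volume t₀ t₁ :=
    ((hg'c.continuousOn.mul hGic).add
      (hg.continuous.continuousOn.mul hGic')).intervalIntegrable_of_Icc ht.le
  rw [intervalIntegral.integral_congr (Set.uIcc_of_le ht.le ▸ hsplit)] at hfirst
  have := intervalIntegral.integral_sub hint₁ hint₂
  rw [hfirst, hparts, sub_zero] at this
  refine Eq.trans ?_ this
  congr 1 with t
  ring
end

section
/- Let a be a real number and n a natural number, and let v : (0, ∞) → ℝ be a differentiable particular solution of the Riccati equation, i.e., v′(x) + v(x)² = a xⁿ for all x > 0. Let u : (0, ∞) → ℝ be differentiable with u(x) ≠ 0 for all x > 0 and satisfying the linear equation u′(x) = 2 v(x) u(x) + 1 for all x > 0. Then z := v + 1/u satisfies the Riccati equation: z′(x) + z(x)² = a xⁿ for all x > 0. -/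
/-- Euler's reduction of the Riccati equation `z' + z² = a xⁿ`:
if `v` is a particular solution and `u` solves the linear equation
`u' = 2 v u + 1` with `u ≠ 0`, then `z = v + u⁻¹` solves the Riccati equation. -/
theorem riccati_particular_solution_substitution
    (a : ℝ) (n : ℕ) (v u : ℝ → ℝ)
    (hv_diff : ∀ x > (0:ℝ), DifferentiableAt ℝ v x)
    (hv : ∀ x > (0:ℝ), deriv v x + v x ^ 2 = a * x ^ n)
    (hu_diff : ∀ x > (0:ℝ), DifferentiableAt ℝ u x)
    (hu_ne : ∀ x > (0:ℝ), u x ≠ 0)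
    (hu : ∀ x > (0:ℝ), deriv u x = 2 * v x * u x + 1) :
    ∀ x > (0:ℝ),
      deriv (fun x => v x + (u x)⁻¹) x + (v x + (u x)⁻¹) ^ 2 = a * x ^ n := by
  intro x hx
  have hne := hu_ne x hx
  have hz : HasDerivAt (fun x => v x + (u x)⁻¹) (deriv v x + -deriv u x / u x ^ 2) x :=
    (hv_diff x hx).hasDerivAt.add ((hu_diff x hx).hasDerivAt.fun_inv hne)
  rw [hz.deriv, hu x hx, ← hv x hx]
  field_simp
  ring
end

section
/- Let P be a real polynomial with coefficients a₀, a₁, …, aₙ, and let q be a real root of P of multiplicity at least k (i.e., (X − q)ᵏ divides P). Then for every natural number j < k, the function y(x) = xʲ e^{qx} satisfies a₀ y + a₁ y′ + a₂ y″ + ⋯ + aₙ y⁽ⁿ⁾ = 0 at every x ∈ ℝ. Consequently, for any constants α, β, …, ς, the function y(x) = e^{qx}(α + βx + γx² + ⋯ + ς x^{k−1}) is a solution containing k arbitrary constants. -/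
open Polynomial in
/-- The operator `u ↦ u' + q u`, which is differentiation conjugated by `x ↦ e^{qx}`. -/
noncomputable def Polynomial.expTwistedDerivative (q : ℝ) : Module.End ℝ ℝ[X] :=
  derivative + algebraMap ℝ (Module.End ℝ ℝ[X]) q

namespace Polynomial

theorem iteratedDeriv_exp_mul_eval (q : ℝ) (u : ℝ[X]) (i : ℕ) :
    iteratedDeriv i (fun x => Real.exp (q * x) * u.eval x) =
      fun x => Real.exp (q * x) * ((expTwistedDerivative q ^ i) u).eval x := by
  induction i with
  | zero => simp
  | succ i ih =>
    rw [iteratedDeriv_succ, ih]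
    funext x
    have hexp : HasDerivAt (fun x => Real.exp (q * x)) (Real.exp (q * x) * q) x := by
      simpa using ((hasDerivAt_id x).const_mul q).exp
    rw [(hexp.fun_mul (((expTwistedDerivative q ^ i) u).hasDerivAt x)).deriv, pow_succ',
      Module.End.mul_apply]
    simp only [expTwistedDerivative, LinearMap.add_apply, Module.algebraMap_end_apply, eval_add,
      eval_smul, smul_eq_mul]
    ring

theorem sum_coeff_mul_iteratedDeriv_exp_mul_eval (P u : ℝ[X]) (q x : ℝ) :
    ∑ i ∈ Finset.range (P.natDegree + 1),
        P.coeff i * iteratedDeriv i (fun x => Real.exp (q * x) * u.eval x) x =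
      Real.exp (q * x) * (aeval (expTwistedDerivative q) P u).eval x := by
  simp only [iteratedDeriv_exp_mul_eval, aeval_eq_sum_range, LinearMap.sum_apply,
    LinearMap.smul_apply, eval_finsetSum, eval_smul, smul_eq_mul, Finset.mul_sum]
  exact Finset.sum_congr rfl fun i _ => by ring

theorem aeval_expTwistedDerivative_eq_zero {P u : ℝ[X]} {q : ℝ} {k : ℕ}
    (hP : (X - C q) ^ k ∣ P) (hu : derivative^[k] u = 0) :
    aeval (expTwistedDerivative q) P u = 0 := by
  obtain ⟨Q, rfl⟩ := hP
  rw [mul_comm, map_mul, Module.End.mul_apply, map_pow, map_sub, aeval_X, aeval_C,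
    expTwistedDerivative, add_sub_cancel_right, Module.End.pow_apply, hu, map_zero]

end Polynomial

/-- Euler's treatment of multiple roots of the characteristic equation: if `q` is a
root of multiplicity at least `k` of the polynomial `P` with coefficients
`a₀, …, aₙ`, then for every `j < k` the function `x ↦ xʲ e^{qx}` solves the ODE
`a₀ y + a₁ y' + ⋯ + aₙ y⁽ⁿ⁾ = 0`; consequently
`x ↦ e^{qx}(α + βx + ⋯ + ς x^{k-1})` is a solution with `k` arbitrary constants. -/
theorem multiple_root_polynomial_exp_solutions
    (P : Polynomial ℝ) (q : ℝ) (k : ℕ)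
    (hq : (Polynomial.X - Polynomial.C q) ^ k ∣ P) :
    (∀ j < k, ∀ x : ℝ,
      ∑ i ∈ Finset.range (P.natDegree + 1),
        P.coeff i * iteratedDeriv i (fun x => x ^ j * Real.exp (q * x)) x = 0) ∧
    (∀ c : ℕ → ℝ, ∀ x : ℝ,
      ∑ i ∈ Finset.range (P.natDegree + 1),
        P.coeff i *
          iteratedDeriv i
            (fun x => Real.exp (q * x) * ∑ j ∈ Finset.range k, c j * x ^ j) x = 0) := by
  have key (u : Polynomial ℝ) (hu : Polynomial.derivative^[k] u = 0) (x : ℝ) :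
      ∑ i ∈ Finset.range (P.natDegree + 1),
        P.coeff i * iteratedDeriv i (fun x => Real.exp (q * x) * u.eval x) x = 0 := by
    rw [Polynomial.sum_coeff_mul_iteratedDeriv_exp_mul_eval,
      Polynomial.aeval_expTwistedDerivative_eq_zero hq hu, Polynomial.eval_zero, mul_zero]
  have hpow (j : ℕ) (hj : j < k) :
      Polynomial.derivative^[k] (Polynomial.X ^ j : Polynomial ℝ) = 0 :=
    Polynomial.iterate_derivative_eq_zero (by simpa using hj)
  refine ⟨fun j hj x => ?_, fun c x => ?_⟩
  · simpa [mul_comm] using key _ (hpow j hj) x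
  · have hsum : Polynomial.derivative^[k]
        (∑ j ∈ Finset.range k, Polynomial.C (c j) * Polynomial.X ^ j) = 0 := by
      rw [Polynomial.iterate_derivative_sum]
      refine Finset.sum_eq_zero fun j hj => ?_
      rw [Polynomial.iterate_derivative_C_mul, hpow j (Finset.mem_range.mp hj), mul_zero]
    simpa [Polynomial.eval_finsetSum] using key _ hsum x
end

section
/- Let n > −1 and α ≠ 0 be real numbers. Define coefficients c₀ = 1 and c_k = (−(n+1)/α)ᵏ / (k! · ∏_{j=1}^{k} (n + j)) for k ≥ 1. Then the power series f(x) = Σ_{k=0}^{∞} c_k xᵏ converges for every real x, and the function f satisfies Euler's hanging-chain equation (x/(n+1)) f″(x) + f′(x) + f(x)/α = 0 for all x ∈ ℝ. -/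
lemma abs_natCast_mul_pow_pred_le (k : ℕ) {y R : ℝ} (hR : 1 ≤ R) (hy : |y| ≤ R) :
    |(k : ℝ) * y ^ (k - 1)| ≤ (2 * R) ^ k := by
  have hk : (k : ℝ) ≤ 2 ^ k := by exact_mod_cast Nat.lt_two_pow_self.le
  rw [abs_mul, abs_pow, Nat.abs_cast, mul_pow]
  have h : |y| ^ (k - 1) ≤ R ^ k :=
    (pow_le_pow_left₀ (abs_nonneg y) hy _).trans (pow_le_pow_right₀ hR (Nat.sub_le k 1))
  gcongr

/-- An everywhere convergent power series may be differentiated term by term. -/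
lemma hasDerivAt_tsum_mul_pow {a : ℕ → ℝ} (ha : ∀ x : ℝ, Summable fun k => a k * x ^ k) (x : ℝ) :
    (Summable fun k : ℕ => ((k : ℝ) + 1) * a (k + 1) * x ^ k) ∧
      HasDerivAt (fun y => ∑' k, a k * y ^ k)
        (∑' k : ℕ, ((k : ℝ) + 1) * a (k + 1) * x ^ k) x := by
  have hR : 1 ≤ |x| + 1 := by linarith [abs_nonneg x]
  have hu : Summable fun k => |a k * (2 * (|x| + 1)) ^ k| := (ha _).abs
  have bound (k : ℕ) (y : ℝ) (hy : y ∈ Metric.ball (0 : ℝ) (|x| + 1)) :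
      ‖a k * ((k : ℝ) * y ^ (k - 1))‖ ≤ |a k * (2 * (|x| + 1)) ^ k| := by
    rw [mem_ball_zero_iff, Real.norm_eq_abs] at hy
    rw [Real.norm_eq_abs, abs_mul, abs_mul (a k) (_ ^ _)]
    exact mul_le_mul_of_nonneg_left
      ((abs_natCast_mul_pow_pred_le k hR hy.le).trans (le_abs_self _)) (abs_nonneg _)
  have hx : x ∈ Metric.ball (0 : ℝ) (|x| + 1) := by simp
  have hs : Summable fun k : ℕ => a k * ((k : ℝ) * x ^ (k - 1)) :=
    Summable.of_norm_bounded hu fun k => bound k x hx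
  have hd := hasDerivAt_tsum_of_isPreconnected hu Metric.isOpen_ball
    (convex_ball (0 : ℝ) (|x| + 1)).isPreconnected
    (fun k y _ => (hasDerivAt_pow k y).const_mul (a k)) bound hx (ha x) hx
  have hshift (k : ℕ) : a (k + 1) * (((k + 1 : ℕ) : ℝ) * x ^ (k + 1 - 1)) =
      ((k : ℝ) + 1) * a (k + 1) * x ^ k := by
    rw [Nat.add_sub_cancel]; push_cast; ring
  refine ⟨((summable_nat_add_iff 1).2 hs).congr hshift, ?_⟩
  rw [hs.tsum_eq_zero_add] at hd
  simpa only [hshift, Nat.cast_zero, zero_mul, mul_zero, zero_add] using hd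

lemma summable_mul_pow_of_recurrence {n q : ℝ} (hn : -1 < n) {c : ℕ → ℝ}
    (hc : ∀ k : ℕ, c (k + 1) * (((k : ℝ) + 1) * (n + (k + 1))) = q * c k) (x : ℝ) :
    Summable fun k => c k * x ^ k := by
  refine summable_of_ratio_norm_eventually_le (r := 1 / 2) (by norm_num) ?_
  obtain ⟨N, hN⟩ := exists_nat_ge (2 * |q * x| / (n + 1))
  filter_upwards [Filter.eventually_ge_atTop N] with k hk
  have hn' : 0 < n + 1 := by linarith
  have hk0 : (0 : ℝ) ≤ k := Nat.cast_nonneg k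
  have hkN : (N : ℝ) ≤ k := by exact_mod_cast hk
  have hD : 0 < ((k : ℝ) + 1) * (n + (k + 1)) := by
    have : 0 < n + ((k : ℝ) + 1) := by linarith
    positivity
  have hqx : 2 * |q * x| ≤ ((k : ℝ) + 1) * (n + (k + 1)) := by
    have := (div_le_iff₀ hn').1 (hN.trans hkN)
    nlinarith
  have key : ‖c (k + 1) * x ^ (k + 1)‖ * (((k : ℝ) + 1) * (n + (k + 1))) =
      |q * x| * ‖c k * x ^ k‖ := by
    rw [Real.norm_eq_abs, Real.norm_eq_abs, ← abs_of_pos hD, ← abs_mul, ← abs_mul]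
    congr 1
    linear_combination x ^ (k + 1) * hc k
  refine le_of_mul_le_mul_right ?_ hD
  rw [key]
  nlinarith [norm_nonneg (c k * x ^ k)]


/-- Euler's power-series solution of the hanging-chain equation
`(x/(n+1)) y'' + y' + y/α = 0`: with `c₀ = 1` and
`c_k = (-(n+1)/α)ᵏ / (k! ∏_{j=1}^{k} (n+j))`, the series `f(x) = Σ c_k xᵏ`
converges for every real `x` and `f` satisfies the equation everywhere. -/
theorem hanging_chain_series_solution
    (n α : ℝ) (hn : -1 < n) (hα : α ≠ 0)
    (c : ℕ → ℝ) (hc0 : c 0 = 1)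
    (hck : ∀ k : ℕ, 1 ≤ k →
      c k = (-(n + 1) / α) ^ k /
        ((k.factorial : ℝ) * ∏ j ∈ Finset.Icc 1 k, (n + (j : ℝ))))
    (f : ℝ → ℝ) (hf : ∀ x : ℝ, f x = ∑' k : ℕ, c k * x ^ k) :
    (∀ x : ℝ, Summable (fun k : ℕ => c k * x ^ k)) ∧
    Differentiable ℝ f ∧ Differentiable ℝ (deriv f) ∧
    ∀ x : ℝ, x / (n + 1) * deriv (deriv f) x + deriv f x + f x / α = 0 := by
  have hn' : n + 1 ≠ 0 := by linarith
  have hc (k : ℕ) : c k = (-(n + 1) / α) ^ k /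
      ((k.factorial : ℝ) * ∏ j ∈ Finset.Icc 1 k, (n + (j : ℝ))) := by
    rcases k.eq_zero_or_pos with rfl | hk
    · simp [hc0]
    · exact hck k hk
  have hrec (k : ℕ) :
      c (k + 1) * (((k : ℝ) + 1) * (n + (k + 1))) = -(n + 1) / α * c k := by
    have hP : ∏ j ∈ Finset.Icc 1 k, (n + (j : ℝ)) ≠ 0 := by
      refine Finset.prod_ne_zero_iff.2 fun j hj => ?_
      have : (1 : ℝ) ≤ j := by exact_mod_cast (Finset.mem_Icc.1 hj).1
      linarith
    have hk0 : (0 : ℝ) ≤ k := Nat.cast_nonneg k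
    have hk1 : (k : ℝ) + 1 ≠ 0 := by positivity
    have hnk : n + ((k : ℝ) + 1) ≠ 0 := by linarith
    have hfact : (k.factorial : ℝ) ≠ 0 := by positivity
    rw [hc (k + 1), hc k, Finset.prod_Icc_succ_top (by omega), Nat.factorial_succ, pow_succ]
    push_cast
    generalize -(n + 1) / α = q
    field_simp
  have hs := summable_mul_pow_of_recurrence hn hrec
  have hs' x := (hasDerivAt_tsum_mul_pow hs x).1
  have hd (x : ℝ) : HasDerivAt f (∑' k : ℕ, ((k : ℝ) + 1) * c (k + 1) * x ^ k) x := by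
    rw [funext hf]
    exact (hasDerivAt_tsum_mul_pow hs x).2
  have hd' (x : ℝ) : HasDerivAt (deriv f)
      (∑' k : ℕ, ((k : ℝ) + 1) * (((k + 1 : ℕ) + 1 : ℝ) * c (k + 1 + 1)) * x ^ k) x := by
    rw [funext fun y => (hd y).deriv]
    exact (hasDerivAt_tsum_mul_pow hs' x).2
  refine ⟨hs, fun x => (hd x).differentiableAt, fun x => (hd' x).differentiableAt, fun x => ?_⟩
  have hmul : HasSum (fun k : ℕ => (k : ℝ) * (((k : ℝ) + 1) * c (k + 1)) * x ^ k)
      (x * deriv (deriv f) x) := by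
    rw [(hd' x).deriv, ← hasSum_nat_add_iff' 1]
    simp only [Finset.sum_range_one, Nat.cast_zero, zero_mul, sub_zero]
    refine ((hasDerivAt_tsum_mul_pow hs' x).1.hasSum.mul_left x).congr_fun ?_
    intro k
    push_cast
    ring
  have h1 := (hs' x).hasSum
  rw [← (hd x).deriv] at h1
  have h0 := (hs x).hasSum
  rw [← hf x] at h0
  have hsum := ((hmul.div_const (n + 1)).add h1).add (h0.div_const α)
  have hzero (k : ℕ) : (k : ℝ) * (((k : ℝ) + 1) * c (k + 1)) * x ^ k / (n + 1) +
      ((k : ℝ) + 1) * c (k + 1) * x ^ k + c k * x ^ k / α = 0 := by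
    have := hrec k
    field_simp at this ⊢
    linear_combination x ^ k * this
  simp only [hzero] at hsum
  rw [div_mul_eq_mul_div]
  exact hsum.unique hasSum_zero
end
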